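/- There exist absolute constants C_T ≥ 1 and C_d ≥ 1 such that the following holds. Let M ∈ ℝ^{m×n} be a rank-r μ-incoherent matrix with singular values Σmax ≥ Σmin > 0, condition number κ = Σmax/Σmin, and set β_T = √(C_T·r·Σmax). Suppose X ∈ ℝ^{m×r}, Y ∈ ℝ^{n×r} satisfy ‖X‖_F ≤ β_T, ‖Y‖_F ≤ β_T and d := ‖X·Yᵀ − M‖_F ≤ Σmin/(C_d·r^{3/2}·κ). Then there exist U ∈ ℝ^{m×r} and V ∈ ℝ^{n×r} such that U·Vᵀ = M, ‖U^{(i)}‖² ≤ (3/2)·(rμ/m)·β_T² for every row i, ‖V^{(j)}‖² ≤ (3/2)·(rμ/n)·β_T² for every row j, the conditional norm bounds hold (‖U‖_F ≤ ‖X‖_F whenever ‖X‖_F > √(2/3)·β_T, and ‖V‖_F ≤ ‖Y‖_F whenever ‖Y‖_F > √(2/3)·β_T), and in addition ‖U − X‖_F·‖V − Y‖_F ≤ d/10; in particular ‖(U − X)·(V − Y)ᵀ‖_F ≤ d/10. -/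

import Mathlib

open Matrix
open scoped Classical

noncomputable section

/-- Frobenius norm of a real matrix. -/
def frob {m n : ℕ} (A : Matrix (Fin m) (Fin n) ℝ) : ℝ :=
  Real.sqrt (∑ i, ∑ j, A i j ^ 2)

/-- Euclidean norm of the `i`-th row of a matrix. -/
def rowNorm {m n : ℕ} (A : Matrix (Fin m) (Fin n) ℝ) (i : Fin m) : ℝ :=
  Real.sqrt (∑ j, A i j ^ 2)

/-- Frobenius inner product `⟨A,B⟩ = trace(AᵀB)`. -/
def finner {m n : ℕ} (A B : Matrix (Fin m) (Fin n) ℝ) : ℝ :=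
  ∑ i, ∑ j, A i j * B i j

/-- Projection onto the set of entries indexed by `Ω` (other entries are set to `0`). -/
def projOmega {m n : ℕ} (Ω : Finset (Fin m × Fin n)) (A : Matrix (Fin m) (Fin n) ℝ) :
    Matrix (Fin m) (Fin n) ℝ :=
  Matrix.of fun i j => if (i, j) ∈ Ω then A i j else 0

/-- `G₀(z) = (max{0, z-1})²`. -/
def G0 (z : ℝ) : ℝ := max 0 (z - 1) ^ 2

/-- `G₀′(z) = 2·max{0, z-1}`. -/
def G0' (z : ℝ) : ℝ := 2 * max 0 (z - 1)

/-- The matrix whose `i`-th row is the `i`-th row of `A` and whose other rows vanish. -/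
def rowMat {m n : ℕ} (A : Matrix (Fin m) (Fin n) ℝ) (i : Fin m) :
    Matrix (Fin m) (Fin n) ℝ :=
  Matrix.of fun i' j => if i' = i then A i j else 0

/-- The regularizer `G(X,Y)`. -/
def Greg {m n r : ℕ} (ρ β1 β2 βT : ℝ) (X : Matrix (Fin m) (Fin r) ℝ)
    (Y : Matrix (Fin n) (Fin r) ℝ) : ℝ :=
  ρ * ∑ i, G0 (3 * rowNorm X i ^ 2 / (2 * β1 ^ 2)) +
    ρ * ∑ j, G0 (3 * rowNorm Y j ^ 2 / (2 * β2 ^ 2)) +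
    ρ * G0 (3 * frob X ^ 2 / (2 * βT ^ 2)) +
    ρ * G0 (3 * frob Y ^ 2 / (2 * βT ^ 2))

/-- The regularized objective `F̃(X,Y)`. -/
def Ftilde {m n r : ℕ} (Ω : Finset (Fin m × Fin n)) (M : Matrix (Fin m) (Fin n) ℝ)
    (ρ β1 β2 βT : ℝ) (X : Matrix (Fin m) (Fin r) ℝ) (Y : Matrix (Fin n) (Fin r) ℝ) : ℝ :=
  (1 / 2) * frob (projOmega Ω (M - X * Yᵀ)) ^ 2 + Greg ρ β1 β2 βT X Y

/-- Gradient of the regularizer with respect to one of the factors. -/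
def gradG1 {m r : ℕ} (ρ β βT : ℝ) (X : Matrix (Fin m) (Fin r) ℝ) :
    Matrix (Fin m) (Fin r) ℝ :=
  (∑ i, (ρ * G0' (3 * rowNorm X i ^ 2 / (2 * β ^ 2)) * (3 / β ^ 2)) • rowMat X i) +
    (ρ * G0' (3 * frob X ^ 2 / (2 * βT ^ 2)) * (3 / βT ^ 2)) • X

/-- `∇_X F̃(X,Y)`. -/
def gradX {m n r : ℕ} (Ω : Finset (Fin m × Fin n)) (M : Matrix (Fin m) (Fin n) ℝ)
    (ρ β1 βT : ℝ) (X : Matrix (Fin m) (Fin r) ℝ) (Y : Matrix (Fin n) (Fin r) ℝ) :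
    Matrix (Fin m) (Fin r) ℝ :=
  projOmega Ω (X * Yᵀ - M) * Y + gradG1 ρ β1 βT X

/-- `∇_Y F̃(X,Y)`. -/
def gradY {m n r : ℕ} (Ω : Finset (Fin m × Fin n)) (M : Matrix (Fin m) (Fin n) ℝ)
    (ρ β2 βT : ℝ) (X : Matrix (Fin m) (Fin r) ℝ) (Y : Matrix (Fin n) (Fin r) ℝ) :
    Matrix (Fin n) (Fin r) ℝ :=
  (projOmega Ω (X * Yᵀ - M))ᵀ * X + gradG1 ρ β2 βT Y

/-- Membership in `K₁`. -/
def K1mem {m n r : ℕ} (β1 β2 : ℝ) (X : Matrix (Fin m) (Fin r) ℝ)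
    (Y : Matrix (Fin n) (Fin r) ℝ) : Prop :=
  (∀ i, rowNorm X i ≤ β1) ∧ ∀ j, rowNorm Y j ≤ β2

/-- Membership in `K₂`. -/
def K2mem {m n r : ℕ} (βT : ℝ) (X : Matrix (Fin m) (Fin r) ℝ)
    (Y : Matrix (Fin n) (Fin r) ℝ) : Prop :=
  frob X ≤ βT ∧ frob Y ≤ βT

/-- Membership in `K(t) = {(X,Y) : ‖M - XYᵀ‖_F ≤ t}`. -/
def Kmem {m n r : ℕ} (M : Matrix (Fin m) (Fin n) ℝ) (t : ℝ)
    (X : Matrix (Fin m) (Fin r) ℝ) (Y : Matrix (Fin n) (Fin r) ℝ) : Prop :=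
  frob (M - X * Yᵀ) ≤ t

theorem frob_nonneg' {m n : ℕ} (A : Matrix (Fin m) (Fin n) ℝ) : 0 ≤ frob A := Real.sqrt_nonneg _

theorem frob_sq {m n : ℕ} (A : Matrix (Fin m) (Fin n) ℝ) : frob A ^ 2 = ∑ i, ∑ j, A i j ^ 2 :=
  Real.sq_sqrt (Finset.sum_nonneg fun _ _ => Finset.sum_nonneg fun _ _ => sq_nonneg _)

theorem frob_sq_trace {m n : ℕ} (A : Matrix (Fin m) (Fin n) ℝ) :
    frob A ^ 2 = Matrix.trace (Aᵀ * A) := by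
  rw [frob_sq, Finset.sum_comm]
  simp [Matrix.trace, Matrix.mul_apply, sq]

theorem frob_transpose {m n : ℕ} (A : Matrix (Fin m) (Fin n) ℝ) : frob Aᵀ = frob A := by
  unfold frob
  rw [Finset.sum_comm]
  rfl

theorem frob_neg {m n : ℕ} (A : Matrix (Fin m) (Fin n) ℝ) : frob (-A) = frob A := by
  simp [frob]

section
attribute [local instance] Matrix.frobeniusNormedAddCommGroup

theorem frob_eq_norm {m n : ℕ} (A : Matrix (Fin m) (Fin n) ℝ) : frob A = ‖A‖ := by
  rw [Matrix.frobenius_norm_def, frob, Real.sqrt_eq_rpow]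
  simp

theorem frob_add_le {m n : ℕ} (A B : Matrix (Fin m) (Fin n) ℝ) :
    frob (A + B) ≤ frob A + frob B := by
  simp only [frob_eq_norm]; exact norm_add_le _ _

theorem frob_mul_le {m n p : ℕ} (A : Matrix (Fin m) (Fin n) ℝ) (B : Matrix (Fin n) (Fin p) ℝ) :
    frob (A * B) ≤ frob A * frob B := by
  simp only [frob_eq_norm]; exact Matrix.frobenius_norm_mul _ _

theorem frob_eq_zero {m n : ℕ} (A : Matrix (Fin m) (Fin n) ℝ) (h : frob A = 0) : A = 0 := by
  rw [frob_eq_norm] at h; exact norm_eq_zero.1 h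
end

theorem frob_iso_mul {m n p : ℕ} (U : Matrix (Fin m) (Fin n) ℝ) (hU : Uᵀ * U = 1)
    (Z : Matrix (Fin n) (Fin p) ℝ) : frob (U * Z) = frob Z := by
  rw [← sq_eq_sq₀ (frob_nonneg' _) (frob_nonneg' _), frob_sq_trace, frob_sq_trace]
  congr 1
  rw [Matrix.transpose_mul, Matrix.mul_assoc, ← Matrix.mul_assoc Uᵀ, hU, Matrix.one_mul]

theorem frob_mul_iso {m n p : ℕ} (U : Matrix (Fin m) (Fin n) ℝ) (hU : Uᵀ * U = 1)
    (Z : Matrix (Fin p) (Fin n) ℝ) : frob (Z * Uᵀ) = frob Z := by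
  rw [← frob_transpose, Matrix.transpose_mul, Matrix.transpose_transpose, frob_iso_mul U hU,
    frob_transpose]

theorem frob_pyth {m n p : ℕ} (U : Matrix (Fin m) (Fin n) ℝ) (hU : Uᵀ * U = 1)
    (Z : Matrix (Fin m) (Fin p) ℝ) :
    frob (Z - U * (Uᵀ * Z)) ^ 2 + frob (Uᵀ * Z) ^ 2 = frob Z ^ 2 := by
  have e : (Z - U * (Uᵀ * Z))ᵀ * (Z - U * (Uᵀ * Z)) = Zᵀ * Z - (Uᵀ * Z)ᵀ * (Uᵀ * Z) := by
    have h1 : (Uᵀ * Z)ᵀ * Uᵀ * (U * (Uᵀ * Z)) = (Uᵀ * Z)ᵀ * (Uᵀ * Z) := by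
      rw [Matrix.mul_assoc, ← Matrix.mul_assoc Uᵀ U, hU, Matrix.one_mul]
    have h2 : Zᵀ * (U * (Uᵀ * Z)) = (Uᵀ * Z)ᵀ * (Uᵀ * Z) := by
      simp [Matrix.transpose_mul, Matrix.mul_assoc]
    have h3 : (Uᵀ * Z)ᵀ * Uᵀ * Z = (Uᵀ * Z)ᵀ * (Uᵀ * Z) := by
      simp [Matrix.mul_assoc]
    rw [Matrix.transpose_sub, Matrix.sub_mul, Matrix.mul_sub, Matrix.mul_sub,
      Matrix.transpose_mul U, h1, h2, h3]
    abel
  rw [frob_sq_trace, e, Matrix.trace_sub, ← frob_sq_trace, ← frob_sq_trace]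
  ring

theorem frob_proj_le {m n p : ℕ} (U : Matrix (Fin m) (Fin n) ℝ) (hU : Uᵀ * U = 1)
    (Z : Matrix (Fin m) (Fin p) ℝ) : frob (Uᵀ * Z) ≤ frob Z := by
  have := frob_pyth U hU Z
  apply le_of_sq_le_sq _ (frob_nonneg' _)
  nlinarith [sq_nonneg (frob (Z - U * (Uᵀ * Z)))]

theorem frob_perp_le {m n p : ℕ} (U : Matrix (Fin m) (Fin n) ℝ) (hU : Uᵀ * U = 1)
    (Z : Matrix (Fin m) (Fin p) ℝ) : frob (Z - U * (Uᵀ * Z)) ≤ frob Z := by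
  have := frob_pyth U hU Z
  apply le_of_sq_le_sq _ (frob_nonneg' _)
  nlinarith [sq_nonneg (frob (Uᵀ * Z))]

theorem frob_mul_diag_sq {m n : ℕ} (A : Matrix (Fin m) (Fin n) ℝ) (v : Fin n → ℝ) :
    frob (A * Matrix.diagonal v) ^ 2 = ∑ k, v k ^ 2 * ∑ i, A i k ^ 2 := by
  rw [frob_sq, Finset.sum_comm]
  simp only [Matrix.mul_diagonal, Finset.mul_sum]
  exact Finset.sum_congr rfl fun _ _ => Finset.sum_congr rfl fun _ _ => by ring

theorem frob_diag_mul_ge {r p : ℕ} (σ : Fin r → ℝ) (s : ℝ) (hs : 0 ≤ s) (h : ∀ k, s ≤ σ k)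
    (Z : Matrix (Fin r) (Fin p) ℝ) : s * frob Z ≤ frob (Matrix.diagonal σ * Z) := by
  apply le_of_sq_le_sq _ (frob_nonneg' _)
  rw [mul_pow, frob_sq, frob_sq, Finset.mul_sum]
  refine Finset.sum_le_sum fun i _ => ?_
  rw [Finset.mul_sum]
  refine Finset.sum_le_sum fun j _ => ?_
  rw [Matrix.diagonal_mul, mul_pow]
  exact mul_le_mul_of_nonneg_right (pow_le_pow_left₀ hs (h i) 2) (sq_nonneg _)

theorem inv_bound {r : ℕ} (P Q : Matrix (Fin r) (Fin r) ℝ) (σ : Fin r → ℝ) (s d β : ℝ)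
    (hs : 0 < s) (h : ∀ k, s ≤ σ k) (hd : frob (P * Qᵀ - Matrix.diagonal σ) ≤ d)
    (hds : d ≤ s / 2) (hP : frob P ≤ β) :
    IsUnit Q.det ∧ ∀ (p : ℕ) (Z : Matrix (Fin p) (Fin r) ℝ),
      frob Z ≤ 2 * β / s * frob (Z * Qᵀ) := by
  have key : ∀ (p : ℕ) (Z : Matrix (Fin r) (Fin p) ℝ), s / 2 * frob Z ≤ frob (P * Qᵀ * Z) := by
    intro p Z
    have h1 := frob_diag_mul_ge σ s hs.le h Z
    have h2 : Matrix.diagonal σ * Z = P * Qᵀ * Z + -((P * Qᵀ - Matrix.diagonal σ) * Z) := by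
      rw [Matrix.sub_mul]; abel
    have h3 := frob_add_le (P * Qᵀ * Z) (-((P * Qᵀ - Matrix.diagonal σ) * Z))
    rw [← h2, frob_neg] at h3
    have h4 := frob_mul_le (P * Qᵀ - Matrix.diagonal σ) Z
    have h5 := mul_le_mul_of_nonneg_right (hd.trans hds) (frob_nonneg' Z)
    linarith
  have hK : (P * Qᵀ).det ≠ 0 := by
    intro h0
    obtain ⟨v, hv, hv0⟩ := Matrix.exists_mulVec_eq_zero_iff.2 h0
    apply hv
    have h1 := key 1 (Matrix.of fun i _ => v i)
    have h2 : P * Qᵀ * (Matrix.of fun i (_ : Fin 1) => v i) = 0 := by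
      ext i j
      exact congrFun hv0 i
    rw [h2] at h1
    have h3 : frob (0 : Matrix (Fin r) (Fin 1) ℝ) = 0 := by simp [frob]
    rw [h3] at h1
    have h4 : frob (Matrix.of fun i (_ : Fin 1) => v i) = 0 := by
      apply le_antisymm _ (frob_nonneg' _)
      by_contra hc
      push Not at hc
      have := mul_pos (half_pos hs) hc
      linarith
    have h5 := frob_eq_zero _ h4
    ext i
    exact congrFun (congrFun h5 i) 0
  have hKu : IsUnit (P * Qᵀ).det := isUnit_iff_ne_zero.2 hK
  have hQ : IsUnit Q.det := by
    rw [isUnit_iff_ne_zero]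
    intro h0
    apply hK
    rw [Matrix.det_mul, Matrix.det_transpose, h0, mul_zero]
  refine ⟨hQ, fun p Z => ?_⟩
  set R := (P * Qᵀ)⁻¹ * P with hR
  have hR1 : R * Qᵀ = 1 := by
    rw [hR, Matrix.mul_assoc, Matrix.nonsing_inv_mul _ hKu]
  have hR2 : Qᵀ * R = 1 := mul_eq_one_comm.1 hR1
  have hR3 : P * Qᵀ * R = P := by rw [Matrix.mul_assoc, hR2, Matrix.mul_one]
  have h1 := key r R
  rw [hR3] at h1
  have h2 : frob R ≤ 2 * β / s := by
    rw [le_div_iff₀ hs]; linarith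
  have h3 : Z = Z * Qᵀ * R := by rw [Matrix.mul_assoc, hR2, Matrix.mul_one]
  calc frob Z = frob (Z * Qᵀ * R) := by rw [← h3]
    _ ≤ frob (Z * Qᵀ) * frob R := frob_mul_le _ _
    _ ≤ frob (Z * Qᵀ) * (2 * β / s) := mul_le_mul_of_nonneg_left h2 (frob_nonneg' _)
    _ = _ := mul_comm _ _

theorem simul_diag {r : ℕ} (A B : Matrix (Fin r) (Fin r) ℝ) (σ : Fin r → ℝ) (hσ : ∀ k, 0 < σ k)
    (hA : IsUnit A.det) (hAB : A * Bᵀ = Matrix.diagonal σ) :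
    ∃ (Q A1 : Matrix (Fin r) (Fin r) ℝ) (l : Fin r → ℝ), Qᵀ * Q = 1 ∧ (∀ k, 0 < l k) ∧
      A = A1 * Qᵀ ∧ B = A1 * Matrix.diagonal l * Qᵀ ∧
      A1 * Matrix.diagonal l * A1ᵀ = Matrix.diagonal σ := by
  have hN : (A⁻¹ * Matrix.diagonal σ * (A⁻¹)ᴴ).PosDef := by
    apply (Matrix.posDef_diagonal_iff.2 hσ).mul_mul_conjTranspose_same
    apply Matrix.vecMul_injective_of_isUnit
    rw [Matrix.isUnit_nonsing_inv_iff]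
    exact (Matrix.isUnit_iff_isUnit_det _).2 hA
  have hsp := hN.1.spectral_theorem
  rw [Unitary.conjStarAlgAut_apply] at hsp
  set Q : Matrix (Fin r) (Fin r) ℝ := (hN.1.eigenvectorUnitary : Matrix (Fin r) (Fin r) ℝ) with hQ
  set l := hN.1.eigenvalues with hl
  have hQ1 : Qᵀ * Q = 1 := by
    have := Matrix.mem_unitaryGroup_iff'.1 hN.1.eigenvectorUnitary.2
    rw [Matrix.star_eq_conjTranspose, Matrix.conjTranspose_eq_transpose_of_trivial] at this
    exact this
  have hQ2 : Q * Qᵀ = 1 := mul_eq_one_comm.1 hQ1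
  have hsp' : A⁻¹ * Matrix.diagonal σ * (A⁻¹)ᵀ = Q * Matrix.diagonal l * Qᵀ := by
    simpa [Matrix.star_eq_conjTranspose, Matrix.conjTranspose_eq_transpose_of_trivial,
      Function.comp_def] using hsp
  have hAA : A * A⁻¹ = 1 := Matrix.mul_nonsing_inv _ hA
  have hAA' : A⁻¹ * A = 1 := Matrix.nonsing_inv_mul _ hA
  have hB : Bᵀ = A⁻¹ * Matrix.diagonal σ := by
    rw [← hAB, ← Matrix.mul_assoc, hAA', Matrix.one_mul]
  have hB2 : B = A * (Q * Matrix.diagonal l * Qᵀ) := by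
    rw [← hsp', ← Matrix.transpose_transpose B, hB, Matrix.transpose_mul, Matrix.diagonal_transpose,
      ← Matrix.mul_assoc, ← Matrix.mul_assoc, hAA, Matrix.one_mul]
  refine ⟨Q, A * Q, l, hQ1, fun k => hN.eigenvalues_pos k, ?_, ?_, ?_⟩
  · rw [Matrix.mul_assoc, hQ2, Matrix.mul_one]
  · rw [hB2]; simp only [Matrix.mul_assoc]
  · have : A * Q * Matrix.diagonal l * (A * Q)ᵀ = B * Aᵀ := by
      rw [hB2, Matrix.transpose_mul]; simp only [Matrix.mul_assoc]
    rw [this, ← Matrix.transpose_transpose B, ← Matrix.transpose_mul, hAB,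
      Matrix.diagonal_transpose]

theorem core_scalar {r : ℕ} (g c v : Fin r → ℝ) (s t : ℝ) (ht : 0 ≤ t) (ht2 : t ≤ 1 / 2)
    (hg : ∀ k, 0 ≤ g k) (hc : ∀ k, 0 ≤ c k) (hcs : ∑ k, c k ≤ s)
    (hv : ∀ k, v k = 1 - t ∨ (v k = (1 - t)⁻¹ ∧ g k ≤ c k)) :
    (∑ k, v k ^ 2 * g k ≤ (1 - t) * ∑ k, g k) ∨ (∑ k, v k ^ 2 * g k ≤ 40 * s) := by
  have h1 : ∀ k, v k ^ 2 * g k ≤ (1 - 3 / 2 * t) * g k + 16 * t * c k := by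
    intro k
    have hgk := hg k
    have hck := hc k
    rcases hv k with h | ⟨h, h'⟩
    · rw [h]
      have : (1 - t) ^ 2 ≤ 1 - 3 / 2 * t := by nlinarith
      have := mul_le_mul_of_nonneg_right this hgk
      have : 0 ≤ 16 * t * c k := by positivity
      linarith
    · have hi : v k ≤ 1 + 2 * t := by
        rw [h, inv_le_iff_one_le_mul₀ (by linarith)]; nlinarith
      have hi0 : 0 ≤ v k := by rw [h]; exact inv_nonneg.2 (by linarith)
      have h2 : v k ^ 2 ≤ 1 + 6 * t := by nlinarith
      have := mul_le_mul_of_nonneg_right h2 hgk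
      have : t * g k ≤ t * c k := mul_le_mul_of_nonneg_left h' ht
      have : 0 ≤ t * c k := by positivity
      nlinarith
  have h2 := Finset.sum_le_sum fun k (_ : k ∈ Finset.univ) => h1 k
  rw [Finset.sum_add_distrib, ← Finset.mul_sum, ← Finset.mul_sum] at h2
  have hg0 : 0 ≤ ∑ k, g k := Finset.sum_nonneg fun k _ => hg k
  have hc0 : 0 ≤ ∑ k, c k := Finset.sum_nonneg fun k _ => hc k
  have h3 : t * ∑ k, c k ≤ t * s := mul_le_mul_of_nonneg_left hcs ht
  by_cases hT : 32 * s ≤ ∑ k, g k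
  · left
    have := mul_le_mul_of_nonneg_left hT ht
    nlinarith
  · right
    push Not at hT
    have : 0 ≤ t * ∑ k, g k := by positivity
    nlinarith

theorem scaling {r : ℕ} (A B : Matrix (Fin r) (Fin r) ℝ) (σ : Fin r → ℝ) (hσ : ∀ k, 0 < σ k)
    (hA : IsUnit A.det) (hAB : A * Bᵀ = Matrix.diagonal σ) (s t : ℝ) (ht : 0 ≤ t)
    (ht2 : t ≤ 1 / 2) (hs : ∑ k, σ k ≤ s) :
    ∃ A' B' : Matrix (Fin r) (Fin r) ℝ, A' * B'ᵀ = Matrix.diagonal σ ∧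
      (frob A' ^ 2 ≤ (1 - t) * frob A ^ 2 ∨ frob A' ^ 2 ≤ 40 * s) ∧
      (frob B' ^ 2 ≤ (1 - t) * frob B ^ 2 ∨ frob B' ^ 2 ≤ 40 * s) ∧
      frob (A' - A) ≤ 2 * t * frob A ∧ frob (B' - B) ≤ 2 * t * frob B := by
  obtain ⟨Q, A1, l, hQ, hl, hA1, hB1, hS⟩ := simul_diag A B σ hσ hA hAB
  set w : Fin r → ℝ := fun k => if l k < 1 then 1 - t else (1 - t)⁻¹ with hw
  set w' : Fin r → ℝ := fun k => if l k < 1 then (1 - t)⁻¹ else 1 - t with hw'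
  have h1t : (1 - t) ≠ 0 := by linarith
  have hww : ∀ k, w k * w' k = 1 := by
    intro k
    simp only [hw, hw']
    split_ifs
    · exact mul_inv_cancel₀ h1t
    · exact inv_mul_cancel₀ h1t
  have hinv : (1 - t)⁻¹ ≤ 1 + 2 * t := by
    rw [inv_le_iff_one_le_mul₀ (by linarith)]; nlinarith
  have hinv1 : 1 ≤ (1 - t)⁻¹ := by
    rw [one_le_inv₀ (by linarith)]; linarith
  have hwm : ∀ k, (w k - 1) ^ 2 ≤ (2 * t) ^ 2 := by
    intro k
    simp only [hw]
    split_ifs <;> nlinarith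
  have hwm' : ∀ k, (w' k - 1) ^ 2 ≤ (2 * t) ^ 2 := by
    intro k
    simp only [hw']
    split_ifs <;> nlinarith
  set a : Fin r → ℝ := fun k => ∑ i, A1 i k ^ 2 with ha
  have ha0 : ∀ k, 0 ≤ a k := fun k => Finset.sum_nonneg fun _ _ => sq_nonneg _
  have hsum : ∑ k, l k * a k ≤ s := by
    have h := congrArg Matrix.trace hS
    rw [Matrix.trace_diagonal] at h
    rw [← h] at hs
    refine le_trans (le_of_eq ?_) hs
    simp only [Matrix.trace, Matrix.diag, Matrix.mul_apply (N := A1ᵀ), Matrix.mul_diagonal,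
      Matrix.transpose_apply, ha, Finset.mul_sum]
    rw [Finset.sum_comm]
    exact Finset.sum_congr rfl fun _ _ => Finset.sum_congr rfl fun _ _ => by ring
  have fd : ∀ v : Fin r → ℝ, frob (A1 * Matrix.diagonal v * Qᵀ) ^ 2 = ∑ k, v k ^ 2 * a k := by
    intro v
    rw [frob_mul_iso Q hQ, frob_mul_diag_sq]
  have eA : A = A1 * Matrix.diagonal (fun _ => 1) * Qᵀ := by
    rw [Matrix.diagonal_one, Matrix.mul_one, hA1]
  have fA : frob A ^ 2 = ∑ k, a k := by
    rw [eA, fd]; simp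
  have fB : frob B ^ 2 = ∑ k, l k ^ 2 * a k := by
    rw [hB1, fd]
  refine ⟨A1 * Matrix.diagonal w * Qᵀ, A1 * Matrix.diagonal (fun k => w' k * l k) * Qᵀ,
    ?_, ?_, ?_, ?_, ?_⟩
  · rw [← hS, Matrix.transpose_mul, Matrix.transpose_mul, Matrix.transpose_transpose,
      Matrix.diagonal_transpose, Matrix.mul_assoc, ← Matrix.mul_assoc Qᵀ, hQ, Matrix.one_mul,
      ← Matrix.mul_assoc, Matrix.mul_assoc A1, Matrix.diagonal_mul_diagonal]
    have : (fun k => w k * (w' k * l k)) = l := by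
      ext k
      rw [← mul_assoc, hww, one_mul]
    rw [this]
  · rw [fd, fA]
    apply core_scalar a (fun k => l k * a k) w s t ht ht2 ha0
      (fun k => mul_nonneg (hl k).le (ha0 k)) hsum
    intro k
    simp only [hw]
    split_ifs with h
    · left; rfl
    · right
      push Not at h
      exact ⟨rfl, le_mul_of_one_le_left (ha0 k) h⟩
  · rw [fd, fB]
    have := core_scalar (fun k => l k ^ 2 * a k) (fun k => l k * a k) w' s t ht ht2
      (fun k => mul_nonneg (sq_nonneg _) (ha0 k))
      (fun k => mul_nonneg (hl k).le (ha0 k)) hsum ?_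
    · simpa only [mul_pow, mul_assoc] using this
    intro k
    simp only [hw']
    split_ifs with h
    · right
      refine ⟨rfl, mul_le_mul_of_nonneg_right ?_ (ha0 k)⟩
      nlinarith [hl k]
    · left; rfl
  · apply le_of_sq_le_sq _ (mul_nonneg (by linarith) (frob_nonneg' _))
    have e : A1 * Matrix.diagonal w * Qᵀ - A = A1 * Matrix.diagonal (fun k => w k - 1) * Qᵀ := by
      conv_lhs => rw [eA]
      rw [← Matrix.sub_mul, ← Matrix.mul_sub, Matrix.diagonal_sub]
    rw [e, fd, mul_pow, fA, Finset.mul_sum]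
    exact Finset.sum_le_sum fun k _ => mul_le_mul_of_nonneg_right (hwm k) (ha0 k)
  · apply le_of_sq_le_sq _ (mul_nonneg (by linarith) (frob_nonneg' _))
    have e : A1 * Matrix.diagonal (fun k => w' k * l k) * Qᵀ - B
        = A1 * Matrix.diagonal (fun k => w' k * l k - l k) * Qᵀ := by
      rw [hB1, ← Matrix.sub_mul, ← Matrix.mul_sub, Matrix.diagonal_sub]
    rw [e, fd, mul_pow, fB, Finset.mul_sum]
    refine Finset.sum_le_sum fun k _ => ?_
    have := mul_le_mul_of_nonneg_right (hwm' k) (mul_nonneg (sq_nonneg (l k)) (ha0 k))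
    calc _ = (w' k - 1) ^ 2 * (l k ^ 2 * a k) := by ring
      _ ≤ _ := this

theorem row_bound {m r : ℕ} (U : Matrix (Fin m) (Fin r) ℝ) (C : Matrix (Fin r) (Fin r) ℝ)
    (i : Fin m) : rowNorm (U * C) i ^ 2 ≤ (∑ k, U i k ^ 2) * frob C ^ 2 := by
  rw [rowNorm, Real.sq_sqrt (Finset.sum_nonneg fun _ _ => sq_nonneg _), frob_sq, Finset.sum_comm,
    Finset.mul_sum]
  refine Finset.sum_le_sum fun j _ => ?_
  rw [Matrix.mul_apply]
  exact Finset.sum_mul_sq_le_sq_mul_sq _ _ _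

theorem aux1 (t x y z : ℝ) (ht : 0 ≤ t) (hy : 0 ≤ y) (h : x ≤ (1 - t) * y) (hz : y ≤ z) :
    x ≤ z := by
  have := mul_nonneg ht hy
  linarith

theorem aux2 (t b : ℝ) (hb : 0 ≤ b) (ht : t ≤ 1 / 100000) : t * b ≤ b / 100000 := by
  have := mul_le_mul_of_nonneg_right ht hb
  linarith

theorem aux3 (x b : ℝ) (h0 : 0 ≤ x) (h : 2 / 3 * b ^ 2 ≤ x ^ 2) : b / 2 ≤ x := by
  apply le_of_sq_le_sq _ h0
  nlinarith [sq_nonneg b]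

theorem aux4 (s d S : ℝ) (hs : 0 ≤ s) (hd : 0 ≤ d) (h : d * (1000000 * s) ≤ S ^ 2) :
    86400 * s * d * d ≤ d / 10 * S ^ 2 := by
  have := mul_le_mul_of_nonneg_left h hd
  have h0 : 0 ≤ s * d * d := by positivity
  nlinarith

theorem aux5 (t : ℝ) (ht0 : 0 ≤ t) : (1 - t) * (1 + t / 2) ^ 2 ≤ 1 := by
  nlinarith [pow_nonneg ht0 3, pow_nonneg ht0 2]

set_option maxHeartbeats 1000000

/-- **Corollary: U, V with `‖U-X‖·‖V-Y‖ ≤ d/10`.** -/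
theorem stmt8 :
    ∃ CT Cd : ℝ, 1 ≤ CT ∧ 1 ≤ Cd ∧
      ∀ (m n r : ℕ), 1 ≤ m → 1 ≤ n → 1 ≤ r →
      ∀ (μ Smax Smin : ℝ)
        (M : Matrix (Fin m) (Fin n) ℝ)
        (Uh : Matrix (Fin m) (Fin r) ℝ) (Vh : Matrix (Fin n) (Fin r) ℝ)
        (σ : Fin r → ℝ),
        Uhᵀ * Uh = 1 → Vhᵀ * Vh = 1 →
        (∀ k, 0 < σ k) → (∀ k l : Fin r, k ≤ l → σ l ≤ σ k) →
        M = Uh * Matrix.diagonal σ * Vhᵀ →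
        ((∀ k, σ k ≤ Smax) ∧ ∃ k, σ k = Smax) →
        ((∀ k, Smin ≤ σ k) ∧ ∃ k, σ k = Smin) →
        (∀ i, ∑ k, Uh i k ^ 2 ≤ μ * r / m) →
        (∀ j, ∑ k, Vh j k ^ 2 ≤ μ * r / n) →
        ∀ (X : Matrix (Fin m) (Fin r) ℝ) (Y : Matrix (Fin n) (Fin r) ℝ),
          frob X ≤ Real.sqrt (CT * r * Smax) →
          frob Y ≤ Real.sqrt (CT * r * Smax) →
          frob (X * Yᵀ - M) ≤ Smin / (Cd * (r : ℝ) ^ ((3 : ℝ) / 2) * (Smax / Smin)) →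
          ∃ (U : Matrix (Fin m) (Fin r) ℝ) (V : Matrix (Fin n) (Fin r) ℝ),
            U * Vᵀ = M ∧
            (∀ i, rowNorm U i ^ 2 ≤ 3 / 2 * (r * μ / m) * Real.sqrt (CT * r * Smax) ^ 2) ∧
            (∀ j, rowNorm V j ^ 2 ≤ 3 / 2 * (r * μ / n) * Real.sqrt (CT * r * Smax) ^ 2) ∧
            (frob X > Real.sqrt (2 / 3) * Real.sqrt (CT * r * Smax) → frob U ≤ frob X) ∧
            (frob Y > Real.sqrt (2 / 3) * Real.sqrt (CT * r * Smax) → frob V ≤ frob Y) ∧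
            frob (U - X) * frob (V - Y) ≤ frob (X * Yᵀ - M) / 10 ∧
            frob ((U - X) * (V - Y)ᵀ) ≤ frob (X * Yᵀ - M) / 10 := by
  refine ⟨200, 1000000, by norm_num, by norm_num, ?_⟩
  intro m n r hm hn hr μ Smax Smin M Uh Vh σ hU hV hσ _ hM hmax hmin hUi hVi X Y hX hY hd
  obtain ⟨hmax, k1, hk1⟩ := hmax
  obtain ⟨hmin, k0, hk0⟩ := hmin
  have hSmin : 0 < Smin := hk0 ▸ hσ k0
  have hSS : Smin ≤ Smax := hk1 ▸ hmin k1
  have hSmax : 0 < Smax := lt_of_lt_of_le hSmin hSS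
  have hr1 : (1 : ℝ) ≤ r := by exact_mod_cast hr
  have hr32 : (r : ℝ) ≤ (r : ℝ) ^ ((3 : ℝ) / 2) := by
    calc (r : ℝ) = (r : ℝ) ^ (1 : ℝ) := (Real.rpow_one _).symm
      _ ≤ _ := Real.rpow_le_rpow_of_exponent_le hr1 (by norm_num)
  set d := frob (X * Yᵀ - M) with hdd
  have hd0 : 0 ≤ d := frob_nonneg' _
  have hd1 : d * (1000000 * (r * Smax)) ≤ Smin ^ 2 := by
    have hpos : 0 < 1000000 * (r : ℝ) ^ ((3 : ℝ) / 2) * (Smax / Smin) := by positivity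
    rw [le_div_iff₀ hpos] at hd
    have h1 : d * (1000000 * (r : ℝ) ^ ((3 : ℝ) / 2) * (Smax / Smin)) * Smin
        = d * (1000000 * ((r : ℝ) ^ ((3 : ℝ) / 2) * Smax)) := by
      field_simp
    have h2 := mul_le_mul_of_nonneg_right hd hSmin.le
    rw [h1] at h2
    have h3 : d * (1000000 * (r * Smax)) ≤ d * (1000000 * ((r : ℝ) ^ ((3 : ℝ) / 2) * Smax)) := by
      gcongr
    nlinarith
  set s : ℝ := r * Smax with hs
  have hsS : Smin ≤ s := by rw [hs]; nlinarith
  have hs0 : 0 < s := lt_of_lt_of_le hSmin hsS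
  have hd2 : d * 1000000 ≤ Smin := by
    have h1 : d * 1000000 * Smin ≤ d * 1000000 * s := by gcongr
    have h2 : d * 1000000 * Smin ≤ Smin * Smin := by nlinarith
    exact le_of_mul_le_mul_right h2 hSmin
  have hσs : ∑ k, σ k ≤ s := by
    calc ∑ k, σ k ≤ ∑ _k : Fin r, Smax := Finset.sum_le_sum fun k _ => hmax k
      _ = s := by simp [hs]
  set β := Real.sqrt (200 * r * Smax) with hβ
  have hβ0 : 0 ≤ β := Real.sqrt_nonneg _
  have hβ2 : β ^ 2 = 200 * s := by
    rw [hβ, Real.sq_sqrt (by positivity), hs]; ring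
  -- projections
  set A := Uhᵀ * X with hA
  set B1 := Vhᵀ * Y with hB1
  have hAX : frob A ≤ frob X := frob_proj_le Uh hU X
  have hBY : frob B1 ≤ frob Y := frob_proj_le Vh hV Y
  have hUM : Uhᵀ * M = Matrix.diagonal σ * Vhᵀ := by
    rw [hM, ← Matrix.mul_assoc, ← Matrix.mul_assoc, hU, Matrix.one_mul]
  have hMV : M * Vh = Uh * Matrix.diagonal σ := by
    rw [hM, Matrix.mul_assoc, hV, Matrix.mul_one]
  have hDV : frob ((X * Yᵀ - M) * Vh) ≤ d := by
    rw [← frob_transpose, Matrix.transpose_mul]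
    refine (frob_proj_le Vh hV _).trans ?_
    rw [frob_transpose]
  have e1 : A * B1ᵀ - Matrix.diagonal σ = Uhᵀ * ((X * Yᵀ - M) * Vh) := by
    rw [Matrix.sub_mul, hMV, Matrix.mul_sub, ← Matrix.mul_assoc Uhᵀ Uh, hU, Matrix.one_mul, hA, hB1,
      Matrix.transpose_mul, Matrix.transpose_transpose]
    simp only [Matrix.mul_assoc]
  have hE : frob (A * B1ᵀ - Matrix.diagonal σ) ≤ d := by
    rw [e1]; exact (frob_proj_le Uh hU _).trans hDV
  have hE' : frob (B1 * Aᵀ - Matrix.diagonal σ) ≤ d := by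
    rw [← frob_transpose, Matrix.transpose_sub, Matrix.transpose_mul, Matrix.transpose_transpose,
      Matrix.diagonal_transpose]
    exact hE
  have hds : d ≤ Smin / 2 := by linarith
  obtain ⟨-, hinvB⟩ := inv_bound A B1 σ Smin d β hSmin hmin hE hds (hAX.trans hX)
  obtain ⟨hAu, hinvA⟩ := inv_bound B1 A σ Smin d β hSmin hmin hE' hds (hBY.trans hY)
  set ε := 2 * β / Smin * d with hε
  have hc0 : 0 ≤ 2 * β / Smin := by positivity
  have hε0 : 0 ≤ ε := by positivity
  have hXp : frob (X - Uh * A) ≤ ε := by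
    refine (hinvB _ _).trans (mul_le_mul_of_nonneg_left ?_ hc0)
    have e : (X - Uh * A) * B1ᵀ
        = (X * Yᵀ - M) * Vh - Uh * (Uhᵀ * ((X * Yᵀ - M) * Vh)) := by
      rw [← e1, Matrix.mul_sub, Matrix.sub_mul (X * Yᵀ), hMV, Matrix.sub_mul, hB1,
        Matrix.transpose_mul, Matrix.transpose_transpose]
      simp only [Matrix.mul_assoc]
      abel
    rw [e]
    exact (frob_perp_le Uh hU _).trans hDV
  have hDU : frob ((X * Yᵀ - M)ᵀ * Uh) ≤ d := by
    rw [← frob_transpose, Matrix.transpose_mul, Matrix.transpose_transpose]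
    exact frob_proj_le Uh hU _
  have hYp : frob (Y - Vh * B1) ≤ ε := by
    refine (hinvA _ _).trans (mul_le_mul_of_nonneg_left ?_ hc0)
    have e : (Y - Vh * B1) * Aᵀ
        = (X * Yᵀ - M)ᵀ * Uh - Vh * (Vhᵀ * ((X * Yᵀ - M)ᵀ * Uh)) := by
      have hMU : Mᵀ * Uh = Vh * Matrix.diagonal σ := by
        have := congrArg Matrix.transpose hUM
        simpa [Matrix.transpose_mul] using this
      have e2 : (X * Yᵀ - M)ᵀ * Uh = Y * Aᵀ - Vh * Matrix.diagonal σ := by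
        rw [Matrix.transpose_sub, Matrix.sub_mul, hMU, hA]
        simp [Matrix.transpose_mul, Matrix.mul_assoc]
      rw [e2, Matrix.mul_sub, Matrix.mul_sub, ← Matrix.mul_assoc Vhᵀ Vh, hV, Matrix.one_mul,
        Matrix.sub_mul, hB1]
      simp only [Matrix.mul_assoc]
      abel
    rw [e]
    exact (frob_perp_le Vh hV _).trans hDU
  set B := (A⁻¹ * Matrix.diagonal σ)ᵀ with hB
  have hAB : A * Bᵀ = Matrix.diagonal σ := by
    rw [hB, Matrix.transpose_transpose, ← Matrix.mul_assoc, Matrix.mul_nonsing_inv _ hAu,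
      Matrix.one_mul]
  have hBB : frob (B - B1) ≤ ε := by
    refine (hinvA _ _).trans (mul_le_mul_of_nonneg_left ?_ hc0)
    have e : (B - B1) * Aᵀ = -(B1 * Aᵀ - Matrix.diagonal σ) := by
      have := congrArg Matrix.transpose hAB
      rw [Matrix.transpose_mul, Matrix.transpose_transpose, Matrix.diagonal_transpose] at this
      rw [Matrix.sub_mul, this]; abel
    rw [e, frob_neg]
    exact hE'
  have hBn : frob B ≤ frob Y + ε := by
    have h := frob_add_le B1 (B - B1)
    rw [add_sub_cancel] at h
    linarith
  set t := 8 * d / Smin with ht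
  have ht0 : 0 ≤ t := by positivity
  have ht1 : t ≤ 1 / 100000 := by
    rw [ht, div_le_iff₀ hSmin]; linarith
  have hεt : ε = t * β / 4 := by rw [hε, ht]; ring
  obtain ⟨A', B', hAB', hA'n, hB'n, hA'd, hB'd⟩ :=
    scaling A B σ hσ hAu hAB s t ht0 (by linarith) hσs
  have hX0 := frob_nonneg' X
  have hY0 := frob_nonneg' Y
  have hA0 := frob_nonneg' A
  have hB0 := frob_nonneg' B
  have hUf : frob (Uh * A') = frob A' := frob_iso_mul Uh hU A'
  have hVf : frob (Vh * B') = frob B' := frob_iso_mul Vh hV B'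
  have hA'32 : frob A' ^ 2 ≤ 3 / 2 * β ^ 2 := by
    rcases hA'n with h | h
    · have : frob A ^ 2 ≤ β ^ 2 := pow_le_pow_left₀ hA0 (hAX.trans hX) 2
      have h2 := aux1 _ _ _ _ ht0 (sq_nonneg _) h this
      have h3 := sq_nonneg β
      linarith
    · rw [hβ2]; linarith
  have htB : t * β ≤ β / 100000 := aux2 _ _ hβ0 ht1
  have hBβ : frob B ≤ 11 / 10 * β := by linarith
  have hB'32 : frob B' ^ 2 ≤ 3 / 2 * β ^ 2 := by
    rcases hB'n with h | h
    · have : frob B ^ 2 ≤ (11 / 10 * β) ^ 2 := pow_le_pow_left₀ hB0 hBβ 2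
      have h2 := aux1 _ _ _ _ ht0 (sq_nonneg _) h this
      have h3 := sq_nonneg β
      linarith
    · rw [hβ2]; linarith
  have hbig : ∀ x : ℝ, x > Real.sqrt (2 / 3) * β → 40 * s ≤ x ^ 2 ∧ β / 2 ≤ x := by
    intro x hx
    have h0 : 0 ≤ Real.sqrt (2 / 3) * β := by positivity
    have h1 : (Real.sqrt (2 / 3) * β) ^ 2 ≤ x ^ 2 := pow_le_pow_left₀ h0 hx.le 2
    rw [mul_pow, Real.sq_sqrt (by norm_num)] at h1
    exact ⟨by rw [hβ2] at h1; linarith, aux3 _ _ (h0.trans hx.le) h1⟩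
  have hUX : frob (Uh * A' - X) ≤ 9 * ε := by
    have e : Uh * A' - X = Uh * (A' - A) + -(X - Uh * A) := by
      rw [Matrix.mul_sub]; abel
    have h := frob_add_le (Uh * (A' - A)) (-(X - Uh * A))
    rw [← e, frob_neg, frob_iso_mul Uh hU] at h
    have h2 : 2 * t * frob A ≤ 2 * t * β := by
      have := hAX.trans hX
      gcongr
    linarith
  have hVY : frob (Vh * B' - Y) ≤ 12 * ε := by
    have e : Vh * B' - Y = Vh * (B' - B) + (Vh * (B - B1) + -(Y - Vh * B1)) := by
      rw [Matrix.mul_sub, Matrix.mul_sub]; abel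
    have h := frob_add_le (Vh * (B' - B)) (Vh * (B - B1) + -(Y - Vh * B1))
    have h' := frob_add_le (Vh * (B - B1)) (-(Y - Vh * B1))
    rw [← e, frob_iso_mul Vh hV] at h
    rw [frob_neg, frob_iso_mul Vh hV] at h'
    have h2 : 2 * t * frob B ≤ 2 * t * (11 / 10 * β) := by
      gcongr
    linarith
  have hprod : frob (Uh * A' - X) * frob (Vh * B' - Y) ≤ d / 10 := by
    have h1 : frob (Uh * A' - X) * frob (Vh * B' - Y) ≤ (9 * ε) * (12 * ε) :=
      mul_le_mul hUX hVY (frob_nonneg' _) (by positivity)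
    refine h1.trans ?_
    have h2 : (9 * ε) * (12 * ε) = (86400 * s * d * d) / Smin ^ 2 := by
      have : (9 * ε) * (12 * ε) = 432 * β ^ 2 * d * d / Smin ^ 2 := by
        rw [hε]; field_simp; ring
      rw [this, hβ2]; ring
    rw [h2, div_le_iff₀ (by positivity)]
    exact aux4 _ _ _ hs0.le hd0 hd1
  refine ⟨Uh * A', Vh * B', ?_, ?_, ?_, ?_, ?_, hprod, ?_⟩
  · rw [hM, Matrix.transpose_mul, Matrix.mul_assoc, ← Matrix.mul_assoc A', hAB',
      ← Matrix.mul_assoc]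
  · intro i
    refine (row_bound Uh A' i).trans ?_
    calc _ ≤ (μ * r / m) * (3 / 2 * β ^ 2) :=
          mul_le_mul (hUi i) hA'32 (sq_nonneg _)
            ((Finset.sum_nonneg fun _ _ => sq_nonneg _).trans (hUi i))
      _ = _ := by ring
  · intro j
    refine (row_bound Vh B' j).trans ?_
    calc _ ≤ (μ * r / n) * (3 / 2 * β ^ 2) :=
          mul_le_mul (hVi j) hB'32 (sq_nonneg _)
            ((Finset.sum_nonneg fun _ _ => sq_nonneg _).trans (hVi j))
      _ = _ := by ring
  · intro hb
    obtain ⟨hb1, hb2⟩ := hbig _ hb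
    rw [hUf]
    apply le_of_sq_le_sq _ hX0
    rcases hA'n with h | h
    · have : frob A ^ 2 ≤ frob X ^ 2 := pow_le_pow_left₀ hA0 hAX 2
      exact aux1 _ _ _ _ ht0 (sq_nonneg _) h this
    · linarith
  · intro hb
    obtain ⟨hb1, hb2⟩ := hbig _ hb
    rw [hVf]
    apply le_of_sq_le_sq _ hY0
    rcases hB'n with h | h
    · have h1 : frob B ≤ (1 + t / 2) * frob Y := by
        have : t * (β / 2) ≤ t * frob Y := mul_le_mul_of_nonneg_left hb2 ht0
        linarith
      have h2 : frob B ^ 2 ≤ ((1 + t / 2) * frob Y) ^ 2 := pow_le_pow_left₀ hB0 h1 2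
      have h3 : (1 - t) * (1 + t / 2) ^ 2 ≤ 1 := aux5 t ht0
      calc frob B' ^ 2 ≤ (1 - t) * frob B ^ 2 := h
        _ ≤ (1 - t) * ((1 + t / 2) * frob Y) ^ 2 :=
          mul_le_mul_of_nonneg_left h2 (by linarith)
        _ = ((1 - t) * (1 + t / 2) ^ 2) * frob Y ^ 2 := by ring
        _ ≤ 1 * frob Y ^ 2 := mul_le_mul_of_nonneg_right h3 (sq_nonneg _)
        _ = _ := one_mul _
    · linarith
  · refine (frob_mul_le _ _).trans ?_
    rw [frob_transpose]
    exact hprod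

end
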